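/- Fix h1 > h2 > 0, λ* ∈ (0,1), and constants 0 < c1 < 1 < c2 < ∞. There exist a positive integer K and a constant c8 > 0 such that for all λ ∈ [λ*,1), all integers M with c1/(1−λ) ≤ M ≤ c2/(1−λ) and M ≥ 2, and all integers r with (|r|+1)K ≤ √(M−1), setting J_r = ( (M−1)β(λ,h1) + rKσ(λ,h1), (M−1)β(λ,h1) + (r+1)Kσ(λ,h1) ), one has min( P(S_{M−1}(λ,h1) ∈ J_r), P(S_{M−1}(λ,h2) ∈ J_r) ) ≥ c8/√(M−1). Here β(λ,t) = e^{−(1−λ)t} and σ(λ,t) are the mean and standard deviation of p_{λ,t}. -/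

import Mathlib

open Set Filter MeasureTheory

/-- Extinction-type parameter of the TKF91 model (deletion rate 1, insertion rate `lam`). -/
noncomputable def eta (lam t : ℝ) : ℝ :=
  (1 - Real.exp (-(1 - lam) * t)) / (1 - lam * Real.exp (-(1 - lam) * t))

/-- TKF91 mortal-link progeny-length pmf `p_{λ,t}`. -/
noncomputable def pTKF (lam t : ℝ) : ℕ → ℝ
  | 0 => eta lam t
  | (n + 1) => (1 - eta lam t) * (1 - lam * eta lam t) * (lam * eta lam t) ^ n

/-- TKF91 immortal-link progeny pmf `q_{λ,t}`. -/
noncomputable def qTKF (lam t : ℝ) (n : ℕ) : ℝ :=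
  (1 - lam * eta lam t) * (lam * eta lam t) ^ n

/-- pmf of `S_M(λ,t)`, a sum of `M` i.i.d. variables with law `p_{λ,t}`
(`M`-fold convolution of `pTKF lam t`). -/
noncomputable def pS (lam t : ℝ) : ℕ → ℕ → ℝ
  | 0 => fun n => if n = 0 then 1 else 0
  | (M + 1) => fun n => ∑ k ∈ Finset.range (n + 1), pS lam t M k * pTKF lam t (n - k)

/-- pmf of the leaf sequence length `N = G + S_M(λ,t)` with `G ~ q_{λ,t}` independent. -/
noncomputable def pLeaf (lam t : ℝ) (M n : ℕ) : ℝ :=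
  ∑ k ∈ Finset.range (n + 1), qTKF lam t k * pS lam t M (n - k)

/-- Joint distribution on `ℕ × ℕ` of the pair of leaf lengths of the two-leaf star tree
of height `h`, with stationary geometric root length. -/
noncomputable def Ldist (lam h : ℝ) (y : ℕ × ℕ) : ℝ :=
  ∑' M : ℕ, (1 - lam) * lam ^ M * (pLeaf lam h M y.1 * pLeaf lam h M y.2)

/-- Mean of `p_{λ,t}`. -/
noncomputable def betaTKF (lam t : ℝ) : ℝ := Real.exp (-(1 - lam) * t)

/-- Standard deviation of `p_{λ,t}`. -/
noncomputable def sdev (lam t : ℝ) : ℝ :=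
  Real.sqrt (∑' n : ℕ, ((n : ℝ) - betaTKF lam t) ^ 2 * pTKF lam t n)

/-- `P(S_M(λ,t) ∈ (a,b))`. -/
noncomputable def probIn (lam t : ℝ) (M : ℕ) (a b : ℝ) : ℝ :=
  ∑' j : ℕ, if (j : ℝ) ∈ Set.Ioo a b then pS lam t M j else 0

/-- CDF of `S_M(λ,t)`. -/
noncomputable def cdfS (lam t : ℝ) (M : ℕ) (x : ℝ) : ℝ :=
  ∑' j : ℕ, if (j : ℝ) ≤ x then pS lam t M j else 0

/-- Standard normal CDF. -/
noncomputable def stdNormalCDF (x : ℝ) : ℝ :=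
  ∫ u in Set.Iic x, Real.exp (-u ^ 2 / 2) / Real.sqrt (2 * Real.pi)

theorem fact_upper (n : ℕ) (hn : 0 < n) :
    (n.factorial : ℝ) ≤ Real.exp 1 * (Real.sqrt n * ((n : ℝ) / Real.exp 1) ^ n) := by
  obtain ⟨k, rfl⟩ : ∃ k, n = k + 1 := ⟨n - 1, by omega⟩
  have h := Stirling.stirlingSeq'_antitone (Nat.zero_le k)
  simp only [Function.comp, Nat.succ_eq_add_one, zero_add, Stirling.stirlingSeq_one] at h
  unfold Stirling.stirlingSeq at h
  have hpos : (0:ℝ) < ((k+1 : ℕ) : ℝ) := by positivity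
  rw [div_le_iff₀ (by positivity)] at h
  refine h.trans (le_of_eq ?_)
  rw [Real.sqrt_mul (by norm_num)]
  field_simp

theorem binom_lower (m k : ℕ) (p : ℝ) (hk : 0 < k) (hkm : k < m) (hp : 0 < p) (hp1 : p < 1) :
    Real.exp (-2) / Real.sqrt m * Real.exp (-(((k : ℝ) - m * p) ^ 2 / (m * (p * (1 - p)))))
      ≤ (m.choose k : ℝ) * p ^ k * (1 - p) ^ (m - k) := by
  obtain ⟨b, rfl⟩ : ∃ b, m = k + b := ⟨m - k, by omega⟩
  have hb : 0 < b := by omega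
  have hr : 0 < 1 - p := by linarith
  set r := 1 - p with hrdef
  rw [Nat.add_sub_cancel_left]
  have ha' : (0:ℝ) < k := by exact_mod_cast hk
  have hb' : (0:ℝ) < b := by exact_mod_cast hb
  have hN : (0:ℝ) < ((k + b : ℕ) : ℝ) := by positivity
  set N : ℝ := ((k + b : ℕ) : ℝ) with hNdef
  have hNab : N = k + b := by simp [hNdef]
  have h1 := fact_upper k hk
  have h2 := fact_upper b hb
  have h3 : Real.sqrt N * (N / Real.exp 1) ^ (k + b) ≤ ((k + b).factorial : ℝ) := by
    refine le_trans ?_ (Stirling.le_factorial_stirling (k + b))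
    gcongr
    have : (1:ℝ) ≤ 2 * Real.pi := by linarith [Real.pi_gt_three]
    nlinarith
  have hch : ((k + b).choose k : ℝ) = ((k+b).factorial : ℝ) / (k.factorial * b.factorial) := by
    rw [Nat.cast_choose ℝ (Nat.le_add_right k b), Nat.add_sub_cancel_left]
  have key : ∀ (x y : ℝ) (a : ℕ), 0 < a → 0 < x → Real.exp (a - a^2 / x) ≤ (x / a) ^ a := by
    intro x _ a ha hx
    have ha2 : (0:ℝ) < a := by exact_mod_cast ha
    have hxa : 0 < x / a := by positivity
    have := Real.one_sub_inv_le_log_of_pos hxa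
    rw [← Real.exp_log (pow_pos hxa a), Real.exp_le_exp, Real.log_pow]
    have h := mul_le_mul_of_nonneg_left this ha2.le
    refine le_trans (le_of_eq ?_) h
    field_simp
  have kx := key (N * p) 0 k hk (by positivity)
  have ky := key (N * r) 0 b hb (by positivity)
  have hexp : Real.exp (-(((k : ℝ) - N * p) ^ 2 / (N * (p * r)))) ≤ (N * p / k) ^ k * (N * r / b) ^ b := by
    refine le_trans (le_of_eq ?_) (mul_le_mul kx ky (Real.exp_pos _).le (by positivity))
    rw [← Real.exp_add]
    congr 1
    have hbk : (b:ℝ) = N - k := by linarith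
    have hpr : p = 1 - r := by linarith
    rw [hbk]
    have : (1 - r) ≠ 0 := by linarith
    rw [hpr]
    field_simp
    ring
  have hsq : Real.exp (-2) / Real.sqrt N ≤ Real.exp (-2) * (Real.sqrt N / (Real.sqrt k * Real.sqrt b)) := by
    rw [div_eq_mul_inv]
    gcongr
    rw [inv_eq_one_div, div_le_div_iff₀ (by positivity) (by positivity), one_mul,
      Real.mul_self_sqrt hN.le, ← Real.sqrt_mul ha'.le]
    apply Real.sqrt_le_iff.2 ⟨hN.le, by rw [hNab]; nlinarith⟩
  have hmid : Real.exp (-2) * (Real.sqrt N / (Real.sqrt k * Real.sqrt b)) * ((N * p / k) ^ k * (N * r / b) ^ b) =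
     Real.sqrt N * (N / Real.exp 1) ^ (k + b) / ((Real.exp 1 * (Real.sqrt k * ((k : ℝ) / Real.exp 1) ^ k)) * (Real.exp 1 * (Real.sqrt b * ((b : ℝ) / Real.exp 1) ^ b))) * p ^ k * r ^ b := by
    have : Real.exp (-2) = 1 / (Real.exp 1 * Real.exp 1) := by
      rw [← Real.exp_add, one_div, ← Real.exp_neg]; norm_num
    rw [this]
    have e := Real.exp_pos 1
    have s1 : 0 < Real.sqrt k := by positivity
    have s2 : 0 < Real.sqrt b := by positivity
    simp only [mul_pow, div_pow, pow_add]
    field_simp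
  calc _ ≤ Real.exp (-2) * (Real.sqrt N / (Real.sqrt k * Real.sqrt b)) * ((N * p / k) ^ k * (N * r / b) ^ b) := by
        gcongr
    _ = _ := hmid
    _ ≤ _ := by
        rw [hch]
        gcongr

theorem mk_pS_aux (f : ℕ → ℝ) (S : ℕ → ℕ → ℝ) (h0 : S 0 = fun n => if n = 0 then 1 else 0)
  (hs : ∀ m, S (m+1) = fun n => ∑ k ∈ Finset.range (n + 1), S m k * f (n - k)) (m : ℕ) :
    PowerSeries.mk (S m) = (PowerSeries.mk f) ^ m := by
  induction m with
  | zero => ext n; simp [h0, PowerSeries.coeff_one]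
  | succ m ih =>
    rw [pow_succ, ← ih]
    ext n
    rw [PowerSeries.coeff_mul, Finset.Nat.sum_antidiagonal_eq_sum_range_succ_mk]
    simp [hs]

theorem geom_pow_coeff (q : ℝ) (d n : ℕ) :
   PowerSeries.coeff n ((PowerSeries.mk fun i => q ^ i) ^ (d+1)) = ((d + n).choose d : ℝ) * q ^ n := by
  have h1 : (PowerSeries.mk fun i => q ^ i) = PowerSeries.rescale q (PowerSeries.mk 1) := by
    ext i; simp [PowerSeries.coeff_rescale]
  rw [h1, ← map_pow, PowerSeries.mk_one_pow_eq_mk_choose_add, PowerSeries.coeff_rescale]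
  simp [mul_comm]

theorem mk_pTKF (lam t : ℝ) : PowerSeries.mk (pTKF lam t) =
    PowerSeries.C ((1 - eta lam t) * (1 - lam * eta lam t)) *
      (PowerSeries.X * PowerSeries.mk fun i => (lam * eta lam t) ^ i) + PowerSeries.C (eta lam t) := by
  ext n
  cases n with
  | zero => simp [pTKF]
  | succ n =>
    rw [map_add, PowerSeries.coeff_C_mul, PowerSeries.coeff_succ_X_mul]
    simp [pTKF, PowerSeries.coeff_C]

theorem pS_eq (lam t : ℝ) (m n : ℕ) : pS lam t m n = ∑ k ∈ Finset.range (m + 1),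
    (m.choose k : ℝ) * ((1 - eta lam t) * (1 - lam * eta lam t)) ^ k * eta lam t ^ (m - k) *
      PowerSeries.coeff n (PowerSeries.X ^ k * (PowerSeries.mk fun i => (lam * eta lam t) ^ i) ^ k) := by
  have h := mk_pS_aux (pTKF lam t) (pS lam t) rfl (fun _ => rfl) m
  have h2 := congrArg (PowerSeries.coeff n) h
  rw [PowerSeries.coeff_mk, mk_pTKF, add_pow, map_sum] at h2
  rw [h2]
  refine Finset.sum_congr rfl fun k _ => ?_
  rw [mul_pow, ← map_pow, ← map_pow, mul_pow]
  have e : ((m.choose k : ℕ) : PowerSeries ℝ) = PowerSeries.C ((m.choose k : ℝ)) := by simp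
  rw [e, PowerSeries.coeff_mul_C, PowerSeries.coeff_mul_C, PowerSeries.coeff_C_mul]
  ring

theorem geom_pow_coeff_nonneg (q : ℝ) (hq : 0 ≤ q) (d n : ℕ) :
   0 ≤ PowerSeries.coeff n ((PowerSeries.mk fun i => q ^ i) ^ d) := by
  cases d with
  | zero => rw [pow_zero, PowerSeries.coeff_one]; split_ifs <;> norm_num
  | succ d => rw [geom_pow_coeff]; positivity

theorem pS_term_nonneg (lam t : ℝ) (m n k : ℕ) (h0 : 0 ≤ eta lam t) (h1 : eta lam t ≤ 1)
    (hq0 : 0 ≤ lam * eta lam t) (hq1 : lam * eta lam t ≤ 1) : 0 ≤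
    (m.choose k : ℝ) * ((1 - eta lam t) * (1 - lam * eta lam t)) ^ k * eta lam t ^ (m - k) *
      PowerSeries.coeff n (PowerSeries.X ^ k * (PowerSeries.mk fun i => (lam * eta lam t) ^ i) ^ k) := by
  have a1 : 0 ≤ 1 - eta lam t := by linarith
  have a2 : 0 ≤ 1 - lam * eta lam t := by linarith
  have : 0 ≤ PowerSeries.coeff n (PowerSeries.X ^ k *
      (PowerSeries.mk fun i => (lam * eta lam t) ^ i) ^ k) := by
    rw [PowerSeries.coeff_X_pow_mul']
    split_ifs
    · exact geom_pow_coeff_nonneg _ hq0 _ _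
    · exact le_rfl
  positivity

theorem pS_nonneg (lam t : ℝ) (m n : ℕ) (h0 : 0 ≤ eta lam t) (h1 : eta lam t ≤ 1)
    (hq0 : 0 ≤ lam * eta lam t) (hq1 : lam * eta lam t ≤ 1) : 0 ≤ pS lam t m n := by
  rw [pS_eq]
  exact Finset.sum_nonneg fun k _ => pS_term_nonneg lam t m n k h0 h1 hq0 hq1

theorem pS_ge (lam t : ℝ) (m n : ℕ) (h0 : 0 ≤ eta lam t) (h1 : eta lam t ≤ 1)
    (hq0 : 0 ≤ lam * eta lam t) (hq1 : lam * eta lam t ≤ 1) (W : Finset ℕ)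
    (hW : ∀ k ∈ W, 1 ≤ k ∧ k ≤ m ∧ k ≤ n) :
    ∑ k ∈ W, ((m.choose k : ℝ) * (1 - eta lam t) ^ k * (1 - (1 - eta lam t)) ^ (m - k)) *
      ((1 - lam * eta lam t) * (((n - 1).choose (k - 1) : ℝ) * (1 - lam * eta lam t) ^ (k - 1) *
        (1 - (1 - lam * eta lam t)) ^ (n - 1 - (k - 1)))) ≤ pS lam t m n := by
  rw [pS_eq]
  have hsub : W ⊆ Finset.range (m + 1) := fun k hk => by
    have := hW k hk
    simp; omega
  refine le_trans (le_of_eq ?_) (Finset.sum_le_sum_of_subset_of_nonneg hsub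
    fun k _ _ => pS_term_nonneg lam t m n k h0 h1 hq0 hq1)
  refine Finset.sum_congr rfl fun k hk => ?_
  obtain ⟨k1, k2, k3⟩ := hW k hk
  obtain ⟨d, rfl⟩ : ∃ d, k = d + 1 := ⟨k - 1, by omega⟩
  obtain ⟨e, rfl⟩ : ∃ e, n = d + 1 + e := ⟨n - (d+1), by omega⟩
  rw [PowerSeries.coeff_X_pow_mul', if_pos k3, geom_pow_coeff]
  have e1 : d + 1 + e - 1 = d + e := by omega
  have e2 : d + 1 + e - 1 - (d + 1 - 1) = e := by omega
  have e3 : d + 1 + e - (d + 1) = e := by omega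
  rw [e1, e3, Nat.add_sub_cancel, Nat.add_sub_cancel_left, mul_pow]
  ring

theorem eta_bounds (lam t : ℝ) (hl : lam < 1) (ht : 0 < t) (hsm : (1 - lam) * t ≤ 1) :
    t / (1 + t) ≤ eta lam t ∧ 1 / (1 + 2 * t) ≤ 1 - eta lam t := by
  set E := Real.exp (-(1 - lam) * t) with hE
  have hEpos : 0 < E := Real.exp_pos _
  have he : 0 < 1 - lam := by linarith
  have hx : 0 < (1 - lam) * t := by positivity
  have hlo : 1 + (1 - lam) * t ≤ E⁻¹ := by
    rw [hE, ← Real.exp_neg]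
    have := Real.add_one_le_exp (-(-(1 - lam) * t))
    linarith
  have hhi : E⁻¹ ≤ 1 + 2 * ((1 - lam) * t) := by
    rw [hE, ← Real.exp_neg]
    have h := Real.abs_exp_sub_one_le (x := (1 - lam) * t) (by rw [abs_of_pos hx]; exact hsm)
    rw [abs_of_pos hx] at h
    have := (abs_le.1 h).2
    have e : -(-(1 - lam) * t) = (1 - lam) * t := by ring
    rw [e]; linarith
  have hlo' : E * (1 + (1 - lam) * t) ≤ 1 := by
    have := mul_le_mul_of_nonneg_left hlo hEpos.le
    rwa [mul_inv_cancel₀ hEpos.ne'] at this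
  have hhi' : 1 ≤ E * (1 + 2 * ((1 - lam) * t)) := by
    have := mul_le_mul_of_nonneg_left hhi hEpos.le
    rwa [mul_inv_cancel₀ hEpos.ne'] at this
  have hE1 : E < 1 := by nlinarith
  have hden : 0 < 1 - lam * E := by nlinarith
  unfold eta
  rw [← hE]
  constructor
  · rw [div_le_div_iff₀ (by positivity) hden]
    nlinarith
  · rw [one_sub_div hden.ne', div_le_div_iff₀ (by positivity) hden]
    nlinarith

theorem beta_lower (lam t : ℝ) : 1 - (1 - lam) * t ≤ betaTKF lam t := by
  unfold betaTKF
  have := Real.add_one_le_exp (-(1 - lam) * t)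
  linarith

theorem beta_le_one (lam t : ℝ) (hl : lam < 1) (ht : 0 < t) : betaTKF lam t ≤ 1 := by
  unfold betaTKF
  rw [Real.exp_le_one_iff]
  nlinarith

theorem sdev_bounds (t : ℝ) (ht : 0 < t) : ∃ s0 s1 : ℝ, 0 < s0 ∧ 0 < s1 ∧ ∀ lam : ℝ,
    0 < lam → lam < 1 → (1 - lam) * t ≤ 1 / 2 → s0 ≤ sdev lam t ∧ sdev lam t ≤ s1 := by
  set q0 : ℝ := 2 * t / (1 + 2 * t) with hq0
  have q0pos : 0 < q0 := by positivity
  have q0lt : q0 < 1 := by rw [hq0, div_lt_one (by positivity)]; linarith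
  set B : ℕ → ℝ := fun n => ((n : ℝ) + 1) ^ 2 * (q0 ^ n / q0) with hB
  have hBs : Summable B := by
    have hn : ‖q0‖ < 1 := by rw [Real.norm_eq_abs, abs_of_pos q0pos]; exact q0lt
    have s2 := summable_pow_mul_geometric_of_norm_lt_one 2 hn
    have s1 := summable_pow_mul_geometric_of_norm_lt_one 1 hn
    have s0 := summable_pow_mul_geometric_of_norm_lt_one 0 hn
    have := ((s2.add (s1.mul_left 2)).add s0).mul_right q0⁻¹
    refine this.congr fun n => ?_
    simp only [hB]
    field_simp
    ring
  refine ⟨Real.sqrt ((1/2)^2 * (t / (1 + t))), Real.sqrt (∑' n, B n) + 1, by positivity,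
    by positivity, ?_⟩
  intro lam hl0 hl1 hsm
  obtain ⟨b1, b2⟩ := eta_bounds lam t hl1 ht (by linarith)
  have hb := beta_lower lam t
  have hb' := beta_le_one lam t hl1 ht
  have htt : 0 < t / (1 + t) := by positivity
  have hpp : 0 < 1 / (1 + 2 * t) := by positivity
  have hetaq : eta lam t ≤ q0 := by
    have : q0 = 1 - 1 / (1 + 2 * t) := by rw [hq0]; field_simp; ring
    linarith
  have hqpos : 0 < lam * eta lam t := by
    have : 0 < eta lam t := by linarith
    positivity
  have hqle : lam * eta lam t ≤ q0 := by nlinarith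
  have hp0 : ∀ n, 0 ≤ pTKF lam t n := by
    intro n
    cases n with
    | zero => simp only [pTKF]; linarith
    | succ n =>
      simp only [pTKF]
      have : 0 ≤ 1 - eta lam t := by linarith
      have : 0 ≤ 1 - lam * eta lam t := by linarith
      positivity
  have hple : ∀ n, pTKF lam t n ≤ q0 ^ n / q0 := by
    intro n
    rw [le_div_iff₀ q0pos]
    cases n with
    | zero => simp only [pTKF, pow_zero]; nlinarith
    | succ n =>
      simp only [pTKF, pow_succ]
      gcongr
      have h1 : (1 - eta lam t) * (1 - lam * eta lam t) ≤ 1 := by nlinarith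
      have h2 : (lam * eta lam t) ^ n ≤ q0 ^ n := by gcongr
      have h3 : 0 ≤ (lam * eta lam t) ^ n := by positivity
      nlinarith
  have hterm : ∀ n : ℕ, ((n : ℝ) - betaTKF lam t) ^ 2 * pTKF lam t n ≤ B n := by
    intro n
    simp only [hB]
    have hn : (0:ℝ) ≤ n := by positivity
    have : ((n : ℝ) - betaTKF lam t) ^ 2 ≤ ((n : ℝ) + 1) ^ 2 := by
      apply sq_le_sq'
      · linarith
      · linarith
    exact mul_le_mul this (hple n) (hp0 n) (by positivity)
  have hnn : ∀ n : ℕ, 0 ≤ ((n : ℝ) - betaTKF lam t) ^ 2 * pTKF lam t n := fun n =>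
    mul_nonneg (sq_nonneg _) (hp0 n)
  have hsum : Summable fun n : ℕ => ((n : ℝ) - betaTKF lam t) ^ 2 * pTKF lam t n :=
    Summable.of_nonneg_of_le hnn hterm hBs
  constructor
  · apply Real.sqrt_le_sqrt
    refine le_trans ?_ (hsum.le_tsum 0 fun n _ => hnn n)
    simp only [pTKF, Nat.cast_zero, zero_sub, neg_sq]
    gcongr
    linarith
  · have := Real.sqrt_le_sqrt (hsum.tsum_le_tsum hterm hBs)
    unfold sdev
    linarith

set_option maxHeartbeats 1000000 in
theorem local_lower (t C c2 : ℝ) (ht : 0 < t) (hC : 0 < C) (hc2 : 0 < c2) :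
    ∃ c : ℝ, 0 < c ∧ ∃ R : ℝ, 0 < R ∧ ∀ lam : ℝ, 1 / 2 ≤ lam → lam < 1 → ∀ m : ℕ,
      R ≤ Real.sqrt m → (m : ℝ) * (1 - lam) ≤ c2 → ∀ n : ℕ,
        |(n : ℝ) - m| ≤ C * Real.sqrt m → c / Real.sqrt m ≤ pS lam t m n := by
  obtain ⟨α, hα⟩ : ∃ α : ℝ, α = 1 / (1 + 2 * t) := ⟨_, rfl⟩
  obtain ⟨γ, hγ⟩ : ∃ γ : ℝ, γ = t / (1 + t) := ⟨_, rfl⟩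
  have α0 : 0 < α := by rw [hα]; positivity
  have γ0 : 0 < γ := by rw [hγ]; positivity
  obtain ⟨D, hD⟩ : ∃ D : ℝ, D = C + c2 + 5 := ⟨_, rfl⟩
  have D0 : 0 < D := by rw [hD]; positivity
  obtain ⟨A1, hA1⟩ : ∃ A : ℝ, A = Real.exp (-2) * Real.exp (-(4 / (α * γ))) := ⟨_, rfl⟩
  obtain ⟨A2, hA2⟩ : ∃ A : ℝ, A = α * (Real.exp (-2) / Real.sqrt (1 + C) *
    Real.exp (-(4 * D ^ 2 / (α * γ)))) := ⟨_, rfl⟩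
  have A10 : 0 < A1 := by rw [hA1]; positivity
  have A20 : 0 < A2 := by rw [hA2]; positivity
  refine ⟨A1 * A2 / 2, by positivity,
    4 + (C + 4) / γ + 3 / α + c2 * t + 2 * (C + 1), by positivity, ?_⟩
  intro lam hl0 hl1 m hR hml n hn
  obtain ⟨s, hs⟩ : ∃ s : ℝ, s = Real.sqrt m := ⟨_, rfl⟩
  rw [← hs] at hR hn ⊢
  have hss : s * s = m := by rw [hs]; exact Real.mul_self_sqrt (by positivity)
  have g1 : 0 < (C + 4) / γ := by positivity
  have g2 : 0 < 3 / α := by positivity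
  have g3 : 0 < c2 * t := by positivity
  have s4 : 4 ≤ s := by linarith
  have sγ : C + 4 ≤ s * γ := by rw [← div_le_iff₀ γ0]; linarith
  have sα : 3 ≤ s * α := by rw [← div_le_iff₀ α0]; linarith
  have sc : c2 * t ≤ s := by linarith
  have sC : 2 * (C + 1) ≤ s := by linarith
  have s0 : 0 < s := by linarith
  have mpos : (0:ℝ) < m := by rw [← hss]; positivity
  have sm : s ≤ m := by rw [← hss]; exact le_mul_of_one_le_left s0.le (by linarith)
  have hlt : (1 - lam) * t ≤ 1 := by
    have : (m : ℝ) * ((1 - lam) * t) ≤ m * 1 := by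
      have := mul_le_mul_of_nonneg_right hml ht.le
      linarith
    exact le_of_mul_le_mul_left this mpos
  obtain ⟨b1, b2⟩ := eta_bounds lam t hl1 ht hlt
  rw [← hγ] at b1
  rw [← hα] at b2
  have hge := pS_ge lam t m n (by linarith) (by linarith)
    (mul_nonneg (by linarith) (by linarith)) (mul_le_one₀ hl1.le (by linarith) (by linarith))
  obtain ⟨η, hη⟩ : ∃ η : ℝ, η = eta lam t := ⟨_, rfl⟩
  rw [← hη] at b1 b2 hge
  obtain ⟨p, hp⟩ : ∃ p : ℝ, p = 1 - η := ⟨_, rfl⟩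
  obtain ⟨p', hp'⟩ : ∃ p' : ℝ, p' = 1 - lam * η := ⟨_, rfl⟩
  rw [← hp, ← hp'] at hge
  have hpα : α ≤ p := by linarith
  have hpη : 1 - p = η := by linarith
  have hp'α : α ≤ p' := by
    have : lam * η ≤ η := mul_le_of_le_one_left (by linarith) hl1.le
    linarith
  have hp'γ : γ / 2 ≤ 1 - p' := by
    have : 1 / 2 * γ ≤ lam * η := mul_le_mul hl0 b1 γ0.le (by linarith)
    linarith
  have hη1 : η < 1 := by linarith
  have hnab := abs_le.1 hn
  have mα : 3 * s ≤ m * α := by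
    have := mul_le_mul_of_nonneg_left sα s0.le
    rw [← hss]; linarith
  have mγ : (C + 4) * s ≤ m * γ := by
    have := mul_le_mul_of_nonneg_left sγ s0.le
    rw [← hss]; linarith
  have mC : 2 * (C + 1) * s ≤ m := by
    have := mul_le_mul_of_nonneg_left sC s0.le
    rw [← hss]; linarith
  obtain ⟨k0, hk0⟩ : ∃ k0 : ℕ, k0 = ⌈(m : ℝ) * p⌉₊ := ⟨_, rfl⟩
  have hmp : 0 ≤ (m : ℝ) * p := mul_nonneg mpos.le (by linarith)
  have mpα : (m : ℝ) * α ≤ m * p := mul_le_mul_of_nonneg_left hpα mpos.le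
  have mpγ : (m : ℝ) * p ≤ m - m * γ := by
    have := mul_le_mul_of_nonneg_left b1 mpos.le
    rw [hp]; linarith
  have Cs : 0 < C * s := by positivity
  have Csm : C * s ≤ C * m := mul_le_mul_of_nonneg_left sm hC.le
  have k0l : (m : ℝ) * p ≤ k0 := by rw [hk0]; exact Nat.le_ceil _
  have k0u : (k0 : ℝ) < m * p + 1 := by rw [hk0]; exact Nat.ceil_lt_add_one hmp
  have sq1 : (Nat.sqrt m : ℝ) ≤ s := by rw [hs]; exact Real.nat_sqrt_le_real_sqrt
  have sq2 : s < Nat.sqrt m + 1 := by rw [hs]; exact Real.real_sqrt_lt_nat_sqrt_succ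
  have hmem : ∀ k ∈ Finset.Ico k0 (k0 + Nat.sqrt m), (m : ℝ) * p ≤ k ∧ (k : ℝ) ≤ m * p + 1 + s := by
    intro k hk
    rw [Finset.mem_Ico] at hk
    have h1 : (k0 : ℝ) ≤ k := by exact_mod_cast hk.1
    have h2 : (k : ℝ) ≤ k0 + Nat.sqrt m := by exact_mod_cast hk.2.le
    constructor <;> linarith
  have hmem2 : ∀ k ∈ Finset.Ico k0 (k0 + Nat.sqrt m), 1 < k ∧ k < m ∧ k < n := by
    intro k hk
    obtain ⟨h1, h2⟩ := hmem k hk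
    refine ⟨?_, ?_, ?_⟩
    · have : (1:ℝ) < k := by linarith
      exact_mod_cast this
    · have : (k:ℝ) < m := by linarith
      exact_mod_cast this
    · have : (k:ℝ) < n := by linarith
      exact_mod_cast this
  refine le_trans ?_ (hge (Finset.Ico k0 (k0 + Nat.sqrt m)) fun k hk => by
    have := hmem2 k hk; omega)
  have hterm : ∀ k ∈ Finset.Ico k0 (k0 + Nat.sqrt m), (A1 / s) * (A2 / s) ≤
     ((m.choose k : ℝ) * p ^ k * (1 - p) ^ (m - k)) *
      (p' * (((n - 1).choose (k - 1) : ℝ) * p' ^ (k - 1) * (1 - p') ^ (n - 1 - (k - 1)))) := by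
    intro k hk
    obtain ⟨h1, h2⟩ := hmem k hk
    obtain ⟨h3, h4, h5⟩ := hmem2 k hk
    have t1 : A1 / s ≤ (m.choose k : ℝ) * p ^ k * (1 - p) ^ (m - k) := by
      have e1 : ((k:ℝ) - m * p) ^ 2 ≤ 4 * m := by
        have : ((k:ℝ) - m * p) ^ 2 ≤ (2 * s) ^ 2 := by
          apply sq_le_sq' <;> linarith
        rw [← hss] at this ⊢
        linarith
      have e2 : α * γ ≤ p * (1 - p) := by
        rw [hpη]; exact mul_le_mul hpα b1 γ0.le (by linarith)
      have e3 : 0 < p * (1 - p) := lt_of_lt_of_le (by positivity) e2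
      have e4 : ((k:ℝ) - m * p) ^ 2 / (m * (p * (1 - p))) ≤ 4 / (α * γ) := by
        rw [div_le_div_iff₀ (by positivity) (by positivity)]
        calc ((k:ℝ) - m * p) ^ 2 * (α * γ) ≤ (4 * m) * (p * (1 - p)) :=
              mul_le_mul e1 e2 (by positivity) (by positivity)
          _ = _ := by ring
      refine le_trans ?_ (binom_lower m k p (by omega) h4 (by linarith) (by linarith))
      rw [hA1, ← hs, ← div_mul_eq_mul_div]
      exact mul_le_mul_of_nonneg_left (Real.exp_le_exp.2 (neg_le_neg e4)) (by positivity)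
    have nc : ((n - 1 : ℕ) : ℝ) = n - 1 := by
      rw [Nat.cast_sub (by omega)]; simp
    have kc : ((k - 1 : ℕ) : ℝ) = k - 1 := by
      rw [Nat.cast_sub (by omega)]; simp
    have nlow : (m : ℝ) / 2 ≤ n - 1 := by linarith
    have nup : (n : ℝ) - 1 ≤ (1 + C) * m := by linarith
    have t2 : A2 / s ≤ p' * (((n - 1).choose (k - 1) : ℝ) * p' ^ (k - 1) *
        (1 - p') ^ (n - 1 - (k - 1))) := by
      have hb := binom_lower (n - 1) (k - 1) p' (by omega) (by omega) (by linarith) (by linarith)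
      rw [nc, kc] at hb
      have hb2 : Real.exp (-2) / (Real.sqrt (1 + C) * s) * Real.exp (-(4 * D ^ 2 / (α * γ))) ≤
          Real.exp (-2) / Real.sqrt ((n:ℝ) - 1) *
          Real.exp (-((((k:ℝ) - 1) - (n - 1) * p') ^ 2 / ((n - 1) * (p' * (1 - p'))))) := by
        have q1 : 0 < (n:ℝ) - 1 := by linarith
        refine mul_le_mul ?_ (Real.exp_le_exp.2 (neg_le_neg ?_)) (by positivity) (by positivity)
        · have : Real.sqrt ((n:ℝ) - 1) ≤ Real.sqrt (1 + C) * s := by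
            rw [hs, ← Real.sqrt_mul (by positivity)]
            exact Real.sqrt_le_sqrt nup
          have : 0 < Real.sqrt ((n:ℝ) - 1) := Real.sqrt_pos.2 q1
          gcongr
        · have hpp : α * (γ / 2) ≤ p' * (1 - p') :=
            mul_le_mul hp'α hp'γ (by positivity) (by linarith)
          have hpp0 : 0 < p' * (1 - p') := lt_of_lt_of_le (by positivity) hpp
          rw [div_le_div_iff₀ (by positivity) (by positivity)]
          have e1 : (((k:ℝ) - 1) - (n - 1) * p') ^ 2 ≤ D ^ 2 * m := by
            have hp'1 : p' ≤ 1 := by linarith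
            have hp'0 : 0 ≤ p' := by linarith
            have w1 : p' - p = (1 - lam) * η := by rw [hp, hp']; ring
            have w2 : 0 ≤ (m:ℝ) * (p' - p) := by
              rw [w1]; have : 0 ≤ 1 - lam := by linarith
              have : 0 ≤ η := by linarith
              positivity
            have w3 : (m:ℝ) * (p' - p) ≤ c2 := by
              rw [w1]; have : 0 ≤ (m:ℝ) * (1 - lam) := by
                have : 0 ≤ 1 - lam := by linarith
                positivity
              have := mul_le_of_le_one_right this hη1.le
              linarith
            have w4 : ((m:ℝ) - n) * p' ≤ C * s := by
              have : ((m:ℝ) - n) * p' ≤ (C * s) * p' := by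
                apply mul_le_mul_of_nonneg_right _ hp'0; linarith
              have : (C * s) * p' ≤ (C * s) * 1 := by gcongr
              linarith
            have w5 : -(C * s) ≤ ((m:ℝ) - n) * p' := by
              have : -(C * s) * p' ≤ ((m:ℝ) - n) * p' := by
                apply mul_le_mul_of_nonneg_right _ hp'0; linarith
              have : (C * s) * p' ≤ (C * s) * 1 := by gcongr
              linarith
            have id1 : ((k:ℝ) - 1) - (n - 1) * p' =
              (k - m * p) - 1 + p' - m * (p' - p) + (m - n) * p' := by ring
            have c2s : c2 ≤ c2 * s := le_mul_of_one_le_right hc2.le (by linarith)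
            have : (((k:ℝ) - 1) - (n - 1) * p') ^ 2 ≤ (D * s) ^ 2 := by
              rw [id1, hD]
              apply sq_le_sq' <;> linarith
            rw [← hss]; linarith
          calc (((k:ℝ) - 1) - (n - 1) * p') ^ 2 * (α * γ) ≤ (D ^ 2 * m) * (α * γ) := by gcongr
            _ = 4 * D ^ 2 * ((m / 2) * (α * (γ / 2))) := by ring
            _ ≤ _ := by gcongr
      calc A2 / s = α * (Real.exp (-2) / (Real.sqrt (1 + C) * s) *
            Real.exp (-(4 * D ^ 2 / (α * γ)))) := by
              rw [hA2]; field_simp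
        _ ≤ _ := by
          apply mul_le_mul hp'α (hb2.trans hb) (by positivity) (by linarith)
    exact mul_le_mul t1 t2 (by positivity) (le_trans (by positivity) t1)
  refine le_trans ?_ (Finset.card_nsmul_le_sum _ _ _ hterm)
  rw [nsmul_eq_mul, Nat.card_Ico, Nat.add_sub_cancel_left]
  have hhalf : s / 2 ≤ Nat.sqrt m := by linarith
  calc A1 * A2 / 2 / s = (s / 2) * ((A1 / s) * (A2 / s)) := by field_simp
    _ ≤ _ := by gcongr

theorem probIn_ge (lam t : ℝ) (m : ℕ) (a b : ℝ) (hS : ∀ n, 0 ≤ pS lam t m n) (n : ℕ)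
    (h1 : a < n) (h2 : (n : ℝ) < b) : pS lam t m n ≤ probIn lam t m a b := by
  unfold probIn
  have hsum : Summable fun j : ℕ => if (j : ℝ) ∈ Set.Ioo a b then pS lam t m j else 0 := by
    apply summable_of_ne_finset_zero (s := Finset.range (⌈b⌉₊))
    intro j hj
    rw [if_neg]
    intro hj2
    apply hj
    rw [Finset.mem_range]
    exact Nat.lt_ceil.2 hj2.2
  have := hsum.le_tsum n fun j _ => by
    split_ifs
    · exact hS j
    · exact le_rfl
  rwa [if_pos ⟨h1, h2⟩] at this

theorem pS_nonneg_of_small (lam t : ℝ) (m : ℕ) (hl0 : 0 < lam) (hl1 : lam < 1) (ht : 0 < t)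
    (h : (1 - lam) * t ≤ 1) (n : ℕ) : 0 ≤ pS lam t m n := by
  obtain ⟨b1, b2⟩ := eta_bounds lam t hl1 ht h
  have g1 : 0 < t / (1 + t) := by positivity
  have g2 : 0 < 1 / (1 + 2 * t) := by positivity
  exact pS_nonneg lam t m n (by linarith) (by linarith)
    (mul_nonneg (by linarith) (by linarith)) (mul_le_one₀ hl1.le (by linarith) (by linarith))

/-- Both `S_{M-1}(λ,h1)` and `S_{M-1}(λ,h2)` put mass at least `c8/√(M-1)` on each of the
length-`Kσ(λ,h1)` subintervals `J_r` around the mean `(M-1)β(λ,h1)`, uniformly for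
`λ ∈ [λ*,1)` and `M ∈ [c1/(1-λ), c2/(1-λ)]`. -/
theorem overlap_on_subintervals (h1 h2 lamstar c1 c2 : ℝ)
    (hh : h1 > h2) (hh2 : h2 > 0) (hl : lamstar ∈ Set.Ioo (0 : ℝ) 1)
    (hc1 : 0 < c1) (hc1' : c1 < 1) (hc2 : 1 < c2) :
    ∃ K : ℕ, 0 < K ∧ ∃ c8 : ℝ, 0 < c8 ∧
      ∀ lam ∈ Set.Ico lamstar (1 : ℝ), ∀ M : ℕ,
        c1 / (1 - lam) ≤ (M : ℝ) → (M : ℝ) ≤ c2 / (1 - lam) → 2 ≤ M →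
        ∀ r : ℤ, (((|r| + 1 : ℤ) : ℝ)) * (K : ℝ) ≤ Real.sqrt ((M : ℝ) - 1) →
          c8 / Real.sqrt ((M : ℝ) - 1) ≤
            min
              (probIn lam h1 (M - 1)
                (((M : ℝ) - 1) * betaTKF lam h1 + (r : ℝ) * (K : ℝ) * sdev lam h1)
                (((M : ℝ) - 1) * betaTKF lam h1 + ((r : ℝ) + 1) * (K : ℝ) * sdev lam h1))
              (probIn lam h2 (M - 1)
                (((M : ℝ) - 1) * betaTKF lam h1 + (r : ℝ) * (K : ℝ) * sdev lam h1)
                (((M : ℝ) - 1) * betaTKF lam h1 + ((r : ℝ) + 1) * (K : ℝ) * sdev lam h1)) := by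
  have h10 : 0 < h1 := by linarith
  have c20 : 0 < c2 := by linarith
  obtain ⟨s0, s1, s00, s10, hsd⟩ := sdev_bounds h1 h10
  obtain ⟨C, hC⟩ : ∃ C : ℝ, C = 2 + c2 * h1 + s1 := ⟨_, rfl⟩
  have C0 : 0 < C := by rw [hC]; positivity
  obtain ⟨d1, d10, R1, R10, H1⟩ := local_lower h1 C c2 h10 C0 c20
  obtain ⟨d2, d20, R2, R20, H2⟩ := local_lower h2 C c2 hh2 C0 c20
  obtain ⟨K, hK⟩ := exists_nat_ge (1 + R1 + R2 + 2 / s0 + 2 * c2 * (h1 + 1) + C)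
  have g1 : 0 < 2 / s0 := by positivity
  have g2 : 0 < 2 * c2 * (h1 + 1) := by positivity
  have K1 : (1 : ℝ) ≤ K := by linarith
  have K0 : 0 < K := by exact_mod_cast (by linarith : (0 : ℝ) < K)
  refine ⟨K, K0, min d1 d2, lt_min d10 d20, ?_⟩
  intro lam hlam M _ hM2 hM r hr
  obtain ⟨hlam0, hlam1⟩ := hlam
  have he : 0 < 1 - lam := by linarith
  obtain ⟨m, rfl⟩ : ∃ m, M = m + 1 := ⟨M - 1, by omega⟩
  have hcast : ((m + 1 : ℕ) : ℝ) - 1 = m := by push_cast; ring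
  rw [hcast] at hr ⊢
  rw [Nat.add_sub_cancel]
  obtain ⟨s, hs⟩ : ∃ s : ℝ, s = Real.sqrt m := ⟨_, rfl⟩
  have hss : s * s = m := by rw [hs]; exact Real.mul_self_sqrt (by positivity)
  have hr2 : (|(r : ℝ)| + 1) * K ≤ s := by rw [hs]; simpa using hr
  have hr3 : 0 ≤ |(r : ℝ)| * K := by positivity
  have hr4 : |(r : ℝ)| * K ≤ s := by linarith
  have sK : (K : ℝ) ≤ s := by linarith
  have sm : s ≤ m := by rw [← hss]; exact le_mul_of_one_le_left (by linarith) (by linarith)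
  have hMl : (m : ℝ) * (1 - lam) ≤ c2 := by
    rw [le_div_iff₀ he] at hM2
    push_cast at hM2
    linarith
  have hKl : (2 * c2 * (h1 + 1)) * (1 - lam) ≤ c2 :=
    le_trans (mul_le_mul_of_nonneg_right (by linarith) he.le) hMl
  have hsmall : (1 - lam) * (h1 + 1) ≤ 1 / 2 := by
    have : c2 * ((1 - lam) * (h1 + 1)) ≤ c2 * (1 / 2) := by linarith
    exact le_of_mul_le_mul_left this c20
  have hp1 : 0 < (1 - lam) * h1 := by positivity
  have hl2 : 1 / 2 ≤ lam := by linarith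
  have hlh1 : (1 - lam) * h1 ≤ 1 / 2 := by linarith
  have hlh2 : (1 - lam) * h2 ≤ 1 := by
    have := mul_le_mul_of_nonneg_left hh.le he.le
    linarith
  obtain ⟨sd0, sd1⟩ := hsd lam (by linarith) hlam1 hlh1
  have hb := beta_lower lam h1
  have hb' := beta_le_one lam h1 hlam1 h10
  obtain ⟨σ, hσ⟩ : ∃ σ : ℝ, σ = sdev lam h1 := ⟨_, rfl⟩
  obtain ⟨β, hβ⟩ : ∃ β : ℝ, β = betaTKF lam h1 := ⟨_, rfl⟩
  rw [← hσ] at sd0 sd1 ⊢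
  rw [← hβ] at hb hb' ⊢
  rw [← hs]
  have hKσ : 2 ≤ K * σ := by
    have : 2 ≤ K * s0 := by rw [← div_le_iff₀ s00]; linarith
    exact this.trans (mul_le_mul_of_nonneg_left sd0 (by linarith))
  obtain ⟨a, ha⟩ : ∃ a : ℝ, a = (m : ℝ) * β + r * K * σ := ⟨_, rfl⟩
  have hbe : (m : ℝ) * β + ((r : ℝ) + 1) * K * σ = a + K * σ := by rw [ha]; ring
  rw [hbe, ← ha]
  have hrk : |(r : ℝ) * K * σ| ≤ s * s1 := by
    rw [abs_mul, abs_mul, abs_of_pos (by linarith : 0 < σ), abs_of_nonneg (by linarith : (0:ℝ) ≤ K)]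
    exact mul_le_mul hr4 sd1 (by linarith) (by linarith)
  obtain ⟨u1, u2⟩ := abs_le.1 hrk
  have m0 : (0:ℝ) ≤ m := by positivity
  have v1 : (m : ℝ) * β ≤ m := mul_le_of_le_one_right m0 hb'
  have v2 : (m : ℝ) - c2 * h1 ≤ m * β := by
    have w1 := mul_le_mul_of_nonneg_left hb m0
    have w2 := mul_le_mul_of_nonneg_right hMl h10.le
    linarith
  have ch : 0 < c2 * h1 := by positivity
  have chs : c2 * h1 ≤ c2 * h1 * s := le_mul_of_one_le_right ch.le (by linarith)
  have Cs : C * s = 2 * s + c2 * h1 * s + s1 * s := by rw [hC]; ring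
  have Csm : C * s ≤ m := by
    rw [← hss]; exact mul_le_mul_of_nonneg_right (by linarith) (by linarith)
  have a0 : 0 ≤ a := by linarith
  have f1 := Nat.floor_le a0
  have f2 := Nat.lt_floor_add_one a
  have hn : |((⌊a⌋₊ + 1 : ℕ) : ℝ) - m| ≤ C * Real.sqrt m := by
    rw [← hs, abs_le]; push_cast
    constructor <;> linarith
  have q1 : a < ((⌊a⌋₊ + 1 : ℕ) : ℝ) := by push_cast; linarith
  have q2 : ((⌊a⌋₊ + 1 : ℕ) : ℝ) < a + K * σ := by push_cast; linarith
  have z1 := H1 lam hl2 hlam1 m (by rw [← hs]; linarith) hMl _ hn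
  have z2 := H2 lam hl2 hlam1 m (by rw [← hs]; linarith) hMl _ hn
  have y1 := probIn_ge lam h1 m a (a + K * σ)
    (pS_nonneg_of_small lam h1 m (by linarith) hlam1 h10 (by linarith)) _ q1 q2
  have y2 := probIn_ge lam h2 m a (a + K * σ)
    (pS_nonneg_of_small lam h2 m (by linarith) hlam1 hh2 hlh2) _ q1 q2
  rw [← hs] at z1 z2
  have spos : 0 ≤ s := by linarith
  refine le_min (le_trans ?_ (z1.trans y1)) (le_trans ?_ (z2.trans y2))
  · exact div_le_div_of_nonneg_right (min_le_left _ _) spos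
  · exact div_le_div_of_nonneg_right (min_le_right _ _) spos
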